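/- arXiv:1612.07773 — 3 statements merged into one kernel-verified Lean document; each statement's English description precedes it below -/
import Mathlib

section
/- (Theorem 1) If a Construction-2 (r,l)-code of capacity α exists, then r·(|Ẽ| + |Ṽ| + 1) ≤ l·α·|Ṽ|; equivalently, the rate r/l of any fractional network coding solution for the Construction-2 sum-network is at most α|Ṽ|/(|Ẽ| + |Ṽ| + 1). -/
/-- Source index set for Construction 2: one source per vertex, one per edge,
and the starred source. -/
abbrev Src2 {V : Type} (G : SimpleGraph V) : Type := V ⊕ ↥G.edgeSet ⊕ Unit

/-- The set `A_i` of sources connected to the tail of bottleneck edge `e_i` in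
Construction 2: the vertex source `i`, the edge sources of edges incident to `i`,
and the starred source when `i` lies on the chosen shortest cycle `c`. -/
def A2 {V : Type} (G : SimpleGraph V) {v : V} (c : G.Walk v v) (i : V) :
    Set (Src2 G) :=
  fun s => match s with
  | Sum.inl j => j = i
  | Sum.inr (Sum.inl e) => i ∈ (e : Sym2 V)
  | Sum.inr (Sum.inr _) => i ∈ c.support

/-- A Construction-2 `(r,l)`-code of capacity `α` over the finite field `A`:
encoding functions `φ i` on each bottleneck edge (depending only on the sources in `A_i`),
such that (i) each vertex-terminal `t_i`, (ii) each edge-terminal `t_e`, and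
(iii) the starred terminal `t_⋆` can decode the sum of all sources. -/
def IsCode2 {V : Type} [Fintype V] [DecidableEq V] (G : SimpleGraph V)
    [DecidableRel G.Adj] {v : V} (c : G.Walk v v)
    (A : Type) [Field A] [Fintype A] (r l α : ℕ)
    (φ : ∀ i : V, (↥(A2 G c i) → (Fin r → A)) → (Fin (α * l) → A)) : Prop :=
  (∀ i : V,
    ∃ ψ : (Fin (α * l) → A) → (↥((A2 G c i)ᶜ) → (Fin r → A)) → (Fin r → A),
      ∀ x : Src2 G → (Fin r → A),
        ψ (φ i (fun a => x a.1)) (fun a => x a.1) = ∑ s, x s) ∧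
  (∀ i j : V, G.Adj i j →
    ∃ ψ : (Fin (α * l) → A) → (Fin (α * l) → A) →
        (↥((A2 G c i ∪ A2 G c j)ᶜ) → (Fin r → A)) → (Fin r → A),
      ∀ x : Src2 G → (Fin r → A),
        ψ (φ i (fun a => x a.1)) (φ j (fun a => x a.1)) (fun a => x a.1) = ∑ s, x s) ∧
  (∃ ψ : (V → (Fin (α * l) → A)) → (Fin r → A),
      ∀ x : Src2 G → (Fin r → A),
        ψ (fun i => φ i (fun a => x a.1)) = ∑ s, x s)

/-- In a shortest cycle, two adjacent vertices are joined by an edge of the cycle. -/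
theorem SimpleGraph.Walk.IsCycle.mem_edges_of_length_eq_girth {V : Type*} [DecidableEq V]
    {G : SimpleGraph V} {v : V} {c : G.Walk v v} (hc : c.IsCycle) (hshort : c.length = G.girth)
    {i j : V} (hi : i ∈ c.support) (hj : j ∈ c.support) (hij : G.Adj i j) :
    s(i, j) ∈ c.edges := by
  by_contra hne
  have key : ∀ {a b : V} (p : G.Walk a b), p.IsPath → G.Adj b a → s(b, a) ∉ p.edges →
      c.length ≤ p.length + 1 := by
    intro a b p hp hba hnot
    have := ((SimpleGraph.Walk.cons_isCycle_iff p hba).2 ⟨hp, hnot⟩).girth_le_length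
    simpa [hshort] using this
  have hd : (c.rotate i hi).IsCycle := hc.rotate hi
  have hjd : j ∈ (c.rotate i hi).support := (c.mem_support_rotate_iff i hi).2 hj
  have hned : s(i, j) ∉ (c.rotate i hi).edges := fun h => hne ((c.rotate_edges i hi).mem_iff.1 h)
  have hedges : ((c.rotate i hi).takeUntil j hjd).edges ++ ((c.rotate i hi).dropUntil j hjd).edges =
      (c.rotate i hi).edges := by
    rw [← SimpleGraph.Walk.edges_append, SimpleGraph.Walk.take_spec]
  have hdpath : ((c.rotate i hi).dropUntil j hjd).IsPath := by
    rw [← (c.rotate i hi).take_spec hjd] at hd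
    exact hd.isPath_of_append_right (SimpleGraph.Walk.not_nil_of_ne hij.ne)
  have htake := key _ (hd.isPath_takeUntil hjd) hij.symm fun h => hned <| by
    rw [← hedges, Sym2.eq_swap]
    exact List.mem_append_left _ h
  have hdrop := key _ hdpath hij fun h => hned <| by
    rw [← hedges]
    exact List.mem_append_right _ h
  have hlen := congrArg List.length hedges
  simp only [List.length_append, SimpleGraph.Walk.length_edges,
    SimpleGraph.Walk.length_rotate] at hlen
  have := hc.three_le_length
  lia

/-- A family on the sources all of whose sums seen by the terminals vanish is zero. -/
theorem eq_zero_of_terminal_sums_eq_zero {V M : Type} [Fintype V] [DecidableEq V]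
    [AddCommGroup M] (G : SimpleGraph V) [DecidableRel G.Adj] {v : V} (c : G.Walk v v)
    (hc : c.IsCycle) (hshort : c.length = G.girth) (f : Src2 G → M)
    (hvertex : ∀ i, ∑ s, (A2 G c i).indicator f s = 0)
    (hedge : ∀ i j, G.Adj i j → ∑ s, (A2 G c i ∪ A2 G c j).indicator f s = 0)
    (hstar : ∑ s, f s = 0) : f = 0 := by
  classical
  have hA : ∀ i j, (Sum.inl j : Src2 G) ∈ A2 G c i ↔ j = i := fun _ _ => Iff.rfl
  have hA' : ∀ i (e : G.edgeSet), (Sum.inr (Sum.inl e) : Src2 G) ∈ A2 G c i ↔ i ∈ (e : Sym2 V) :=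
    fun _ _ => Iff.rfl
  have hA'' : ∀ i u, (Sum.inr (Sum.inr u) : Src2 G) ∈ A2 G c i ↔ i ∈ c.support :=
    fun _ _ => Iff.rfl
  have hv : ∀ i, f (Sum.inl i) + ((∑ e : G.edgeSet, if i ∈ (e : Sym2 V) then
      f (Sum.inr (Sum.inl e)) else 0) +
      if i ∈ c.support then f (Sum.inr (Sum.inr ())) else 0) = 0 := by
    intro i
    simpa [Fintype.sum_sum_type, Set.indicator_apply, hA, hA', hA''] using hvertex i
  have hinter : ∀ i j, G.Adj i j → ∑ s, (A2 G c i ∩ A2 G c j).indicator f s = 0 := by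
    intro i j hij
    have h : ∑ s, ((A2 G c i ∪ A2 G c j).indicator f s + (A2 G c i ∩ A2 G c j).indicator f s) =
        ∑ s, ((A2 G c i).indicator f s + (A2 G c j).indicator f s) :=
      Finset.sum_congr rfl fun s _ => Set.indicator_union_add_inter_apply f _ _ s
    simpa [Finset.sum_add_distrib, hvertex, hedge i j hij] using h
  have he : ∀ e : G.edgeSet, f (Sum.inr (Sum.inl e)) +
      (if (e : Sym2 V) ∈ c.edges then f (Sum.inr (Sum.inr ())) else 0) = 0 := by
    rintro ⟨e, he⟩
    induction e with | _ i j => ?_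
    have hij : G.Adj i j := he
    have hs : (s(i, j) ∈ c.edges) ↔ i ∈ c.support ∧ j ∈ c.support :=
      ⟨fun h => ⟨c.fst_mem_support_of_mem_edges h, c.snd_mem_support_of_mem_edges h⟩,
        fun h => hc.mem_edges_of_length_eq_girth hshort h.1 h.2 hij⟩
    have h1 : ∀ k, ¬ (k = i ∧ k = j) := fun k h => hij.ne (h.1.symm.trans h.2)
    have h2 : ∀ e : G.edgeSet, (i ∈ (e : Sym2 V) ∧ j ∈ (e : Sym2 V)) ↔ e = ⟨s(i, j), he⟩ :=
      fun e => by rw [Sym2.mem_and_mem_iff hij.ne, Subtype.ext_iff]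
    have h := hinter i j hij
    simp only [Fintype.sum_sum_type, Set.indicator_apply, Set.mem_inter_iff, hA, hA', hA''] at h
    simpa [h1, h2, hs] using h
  have hlen : ∑ i, (if i ∈ c.support then f (Sum.inr (Sum.inr ())) else 0) =
      c.length • f (Sum.inr (Sum.inr ())) := by
    have : ({i | i ∈ c.support} : Finset V) = c.support.tail.toFinset := by
      ext i
      rw [Finset.mem_filter_univ, List.mem_toFinset, SimpleGraph.Walk.mem_support_iff]
      exact or_iff_right_of_imp fun h => h ▸ c.end_mem_tail_support hc.not_nil
    rw [← Finset.sum_filter, Finset.sum_const, this, List.toFinset_card_of_nodup hc.support_nodup,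
      List.length_tail, SimpleGraph.Walk.length_support, Nat.add_sub_cancel]
  have hlen' : ∑ e : G.edgeSet, (if (e : Sym2 V) ∈ c.edges then f (Sum.inr (Sum.inr ())) else 0) =
      c.length • f (Sum.inr (Sum.inr ())) := by
    have : ({e | (e : Sym2 V) ∈ c.edges} : Finset G.edgeSet).map (Function.Embedding.subtype _) =
        c.edges.toFinset := by
      ext e
      simpa using fun h => c.edges_subset_edgeSet h
    rw [← Finset.sum_filter, Finset.sum_const, ← Finset.card_map (Function.Embedding.subtype _),
      this, List.toFinset_card_of_nodup hc.edges_nodup, SimpleGraph.Walk.length_edges]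
  have hdouble : ∑ i, ∑ e : G.edgeSet, (if i ∈ (e : Sym2 V) then f (Sum.inr (Sum.inl e)) else 0) =
      (∑ e : G.edgeSet, f (Sum.inr (Sum.inl e))) + ∑ e : G.edgeSet, f (Sum.inr (Sum.inl e)) := by
    rw [Finset.sum_comm, ← Finset.sum_add_distrib]
    refine Finset.sum_congr rfl ?_
    rintro ⟨e, he⟩ -
    induction e with | _ i j => ?_
    have hij : G.Adj i j := he
    rw [← Finset.sum_filter]
    have : ({k | k ∈ s(i, j)} : Finset V) = {i, j} := by ext; simp
    rw [this, Finset.sum_pair hij.ne]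
  have hstar0 : f (Sum.inr (Sum.inr ())) = 0 := by
    have hV := Finset.sum_eq_zero fun i (_ : i ∈ Finset.univ) => hv i
    have hE := Finset.sum_eq_zero fun e (_ : e ∈ Finset.univ) => he e
    rw [Finset.sum_add_distrib, Finset.sum_add_distrib, hdouble, hlen] at hV
    rw [Finset.sum_add_distrib, hlen'] at hE
    simp only [Fintype.sum_sum_type, Finset.univ_unique, Finset.sum_singleton] at hstar
    calc f (Sum.inr (Sum.inr ()))
        = (∑ i, f (Sum.inl i) + (∑ e, f (Sum.inr (Sum.inl e)) + f (Sum.inr (Sum.inr ())))) -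
          (∑ i, f (Sum.inl i) + (∑ e, f (Sum.inr (Sum.inl e)) + ∑ e, f (Sum.inr (Sum.inl e)) +
            c.length • f (Sum.inr (Sum.inr ())))) +
          (∑ e, f (Sum.inr (Sum.inl e)) + c.length • f (Sum.inr (Sum.inr ()))) := by abel
      _ = 0 := by rw [hV, hE, sub_zero, add_zero]; exact hstar
  have he0 : ∀ e, f (Sum.inr (Sum.inl e)) = 0 := fun e => by simpa [hstar0] using he e
  have hv0 : ∀ i, f (Sum.inl i) = 0 := fun i => by simpa [hstar0, he0] using hv i
  funext s
  obtain i | e | u := s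
  exacts [hv0 i, he0 e, hstar0]

/-- A code separates source configurations. -/
theorem IsCode2.injective {V : Type} [Fintype V] [DecidableEq V]
    {G : SimpleGraph V} [DecidableRel G.Adj] {v : V} {c : G.Walk v v}
    (hc : c.IsCycle) (hshort : c.length = G.girth)
    {A : Type} [Field A] [Fintype A] {r l α : ℕ}
    {φ : ∀ i : V, (↥(A2 G c i) → (Fin r → A)) → (Fin (α * l) → A)}
    (hcode : IsCode2 G c A r l α φ) :
    Function.Injective fun (x : Src2 G → Fin r → A) i => φ i fun a => x a.1 := by
  classical
  obtain ⟨hvertex, hedge, ψ, hψ⟩ := hcode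
  intro x y hxy
  have hφ : ∀ i, φ i (fun a => x a.1) = φ i (fun a => y a.1) := congrFun hxy
  have hres : ∀ (i : V) (T : Set (Src2 G)) (z : Src2 G → Fin r → A), A2 G c i ⊆ T →
      (fun a : A2 G c i => T.indicator z a.1) = fun a => z a.1 := fun i T z h =>
    funext fun a => Set.indicator_of_mem (h a.2) z
  have hcompl : ∀ (T : Set (Src2 G)) (z : Src2 G → Fin r → A),
      (fun a : ↥Tᶜ => T.indicator z a.1) = 0 := fun T z =>
    funext fun a => Set.indicator_of_notMem a.2 z
  refine sub_eq_zero.1 (eq_zero_of_terminal_sums_eq_zero G c hc hshort (x - y) ?_ ?_ ?_)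
  · intro i
    obtain ⟨ψ, hψ⟩ := hvertex i
    have hx := hψ ((A2 G c i).indicator x)
    have hy := hψ ((A2 G c i).indicator y)
    rw [hres i _ _ subset_rfl, hcompl] at hx hy
    rw [Set.indicator_sub']
    simp only [Pi.sub_apply, Finset.sum_sub_distrib]
    rw [← hx, ← hy, hφ, sub_self]
  · intro i j hij
    obtain ⟨ψ, hψ⟩ := hedge i j hij
    have hx := hψ ((A2 G c i ∪ A2 G c j).indicator x)
    have hy := hψ ((A2 G c i ∪ A2 G c j).indicator y)
    rw [hres i _ _ Set.subset_union_left, hres j _ _ Set.subset_union_right, hcompl] at hx hy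
    rw [Set.indicator_sub']
    simp only [Pi.sub_apply, Finset.sum_sub_distrib]
    rw [← hx, ← hy, hφ, hφ, sub_self]
  · simp only [Pi.sub_apply, Finset.sum_sub_distrib]
    rw [← hψ x, ← hψ y, sub_eq_zero]
    exact congrArg ψ hxy

/-- **Theorem 1.** If a Construction-2 `(r,l)`-code of capacity `α` exists for the
sum-network built from the graph `G` (with shortest cycle `c`), then
`r·(|Ẽ| + |Ṽ| + 1) ≤ l·α·|Ṽ|`; i.e. the rate `r/l` is at most
`α|Ṽ|/(|Ẽ| + |Ṽ| + 1)`. -/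
theorem construction2_rate_upper_bound {V : Type} [Fintype V] [DecidableEq V]
    (G : SimpleGraph V) [DecidableRel G.Adj] (hG : G.Connected) {v : V} (c : G.Walk v v)
    (hc : c.IsCycle) (hshort : c.length = G.girth)
    (A : Type) [Field A] [Fintype A] (r l α : ℕ) (hr : 0 < r) (hl : 0 < l) (hα : 0 < α)
    (φ : ∀ i : V, (↥(A2 G c i) → (Fin r → A)) → (Fin (α * l) → A))
    (hcode : IsCode2 G c A r l α φ) :
    r * (G.edgeFinset.card + Fintype.card V + 1) ≤ l * (α * Fintype.card V) := by
  have h := Fintype.card_le_of_injective _ (hcode.injective hc hshort)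
  simp only [Fintype.card_fun, Fintype.card_fin, Fintype.card_sum, Fintype.card_unit,
    ← pow_mul, ← SimpleGraph.edgeFinset_card] at h
  rw [Nat.pow_le_pow_iff_right Fintype.one_lt_card] at h
  linarith
end

section
/- Let G̃ = (Ṽ, Ẽ) be a finite connected simple graph that admits a feasible CODE-FEAS-1 assignment, let A be a finite field, and let α ≥ 1 be an integer. Then the capacity of the Construction-1 sum-network built from G̃ with bottleneck capacity α equals α|Ṽ|/(|Ṽ|+|Ẽ|): there exists a Construction-1 (α|Ṽ|, |Ṽ|+|Ẽ|)-code of capacity α, and every Construction-1 (r,l)-code of capacity α satisfies r·(|Ṽ|+|Ẽ|) ≤ l·α·|Ṽ|. -/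
/-- Source index set for Construction 1: one source per vertex and one per edge. -/
abbrev Src1 {V : Type} (G : SimpleGraph V) : Type := V ⊕ ↥G.edgeSet

/-- The set `A_i` of sources connected to the tail of bottleneck edge `e_i` in
Construction 1: the vertex source `i` and the edge sources of edges incident to `i`. -/
def A1 {V : Type} (G : SimpleGraph V) (i : V) : Set (Src1 G) :=
  fun s => match s with
  | Sum.inl j => j = i
  | Sum.inr e => i ∈ (e : Sym2 V)

/-- A Construction-1 `(r,l)`-code of capacity `α` over the finite field `A`:
encoding functions `φ i` on each bottleneck edge (depending only on the sources in `A_i`),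
such that (i) each vertex-terminal `t_i`, (ii) each edge-terminal `t_e`, and
(iii) the starred terminal `t_⋆` can decode the sum of all sources. -/
def IsCode1 {V : Type} [Fintype V] [DecidableEq V] (G : SimpleGraph V)
    [DecidableRel G.Adj] (A : Type) [Field A] [Fintype A] (r l α : ℕ)
    (φ : ∀ i : V, (↥(A1 G i) → (Fin r → A)) → (Fin (α * l) → A)) : Prop :=
  (∀ i : V,
    ∃ ψ : (Fin (α * l) → A) → (↥((A1 G i)ᶜ) → (Fin r → A)) → (Fin r → A),
      ∀ x : Src1 G → (Fin r → A),
        ψ (φ i (fun a => x a.1)) (fun a => x a.1) = ∑ s, x s) ∧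
  (∀ i j : V, G.Adj i j →
    ∃ ψ : (Fin (α * l) → A) → (Fin (α * l) → A) →
        (↥((A1 G i ∪ A1 G j)ᶜ) → (Fin r → A)) → (Fin r → A),
      ∀ x : Src1 G → (Fin r → A),
        ψ (φ i (fun a => x a.1)) (φ j (fun a => x a.1)) (fun a => x a.1) = ∑ s, x s) ∧
  (∃ ψ : (V → (Fin (α * l) → A)) → (Fin r → A),
      ∀ x : Src1 G → (Fin r → A),
        ψ (fun i => φ i (fun a => x a.1)) = ∑ s, x s)

/-- A feasible CODE-FEAS-1 assignment: nonnegative integers `m e i` for each edge `e` and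
endpoint `i` of `e` with `m e i + m e j = |Ṽ|` for every edge `e = {i,j}` and
`∑_{e ∋ i} m e i ≤ |Ẽ|` for every vertex `i`. -/
def Feas1 {V : Type} [Fintype V] [DecidableEq V] (G : SimpleGraph V)
    [DecidableRel G.Adj] (m : Sym2 V → V → ℕ) : Prop :=
  (∀ i j : V, G.Adj i j → m s(i, j) i + m s(i, j) j = Fintype.card V) ∧
  (∀ i : V, ∑ e ∈ G.edgeFinset.filter (fun e => i ∈ e), m e i ≤ G.edgeFinset.card)

/-- The sum over all sources of the part of a configuration supported on `B`. -/
noncomputable def sumOn {S M : Type} [Fintype S] [AddCommGroup M] (B : Set S) (x : S → M) : M :=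
  ∑ s, B.indicator x s

section SumOn

variable {S M : Type} [Fintype S] [AddCommGroup M]

lemma sumOn_sub (B : Set S) (x y : S → M) : sumOn B (x - y) = sumOn B x - sumOn B y := by
  simp [sumOn, Set.indicator_sub']

lemma sumOn_add_sumOn_compl (B : Set S) (x : S → M) : sumOn B x + sumOn Bᶜ x = ∑ s, x s := by
  rw [sumOn, sumOn, ← Finset.sum_add_distrib]
  exact Finset.sum_congr rfl fun s _ => congrFun (Set.indicator_self_add_compl B x) s

lemma sumOn_congr {B : Set S} {x y : S → M} (h : ∀ s ∈ B, x s = y s) :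
    sumOn B x = sumOn B y := by
  rw [sumOn, Set.indicator_congr h, sumOn]

lemma sumOn_union_add_inter (B C : Set S) (x : S → M) :
    sumOn (B ∪ C) x + sumOn (B ∩ C) x = sumOn B x + sumOn C x := by
  simp only [sumOn, ← Finset.sum_add_distrib]
  exact Finset.sum_congr rfl fun s _ => Set.indicator_union_add_inter_apply x B C s

lemma sumOn_singleton (t : S) (x : S → M) : sumOn {t} x = x t := by
  classical
  rw [sumOn, Finset.sum_eq_single t] <;> simp +contextual

/-- If the encoding `f` of the sources in `B`, together with the sources outside `B`, determines
the sum of all sources, then `f` determines the sum of the sources in `B`. -/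
lemma sumOn_eq_of_decodes {T : Type} {B : Set S} {f : (S → M) → T}
    (hf : ∀ x y, (∀ s ∈ B, x s = y s) → f x = f y) {ψ : T → (↥Bᶜ → M) → M}
    (hψ : ∀ x : S → M, ψ (f x) (fun a => x a.1) = ∑ s, x s) {x y : S → M}
    (h : f x = f y) : sumOn B x = sumOn B y := by
  have key : ∀ z : S → M, sumOn B z = ψ (f z) 0 := by
    intro z
    rw [sumOn, ← hψ, hf (B.indicator z) z fun s hs => Set.indicator_of_mem hs z]
    congr 1
    funext a
    exact Set.indicator_of_notMem a.2 z
  rw [key, key, h]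

end SumOn

section Sources

variable {V : Type} {G : SimpleGraph V}

lemma A1_inter_of_adj {i j : V} (h : G.Adj i j) :
    A1 G i ∩ A1 G j = {Sum.inr ⟨s(i, j), h⟩} := by
  ext s
  rcases s with k | e
  · simp only [Set.mem_inter_iff, Set.mem_singleton_iff, reduceCtorEq, iff_false]
    rintro ⟨rfl : k = i, rfl : k = j⟩
    exact G.loopless.irrefl _ h
  · rw [Set.mem_singleton_iff, Sum.inr.injEq, Subtype.ext_iff]
    exact Sym2.mem_and_mem_iff h.ne

variable [Fintype V] [Fintype G.edgeSet] {M : Type} [AddCommGroup M]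

lemma eq_zero_of_sumOn_A1_eq_zero {d : Src1 G → M}
    (hV : ∀ i, sumOn (A1 G i) d = 0) (hE : ∀ e, d (Sum.inr e) = 0) : d = 0 := by
  funext s
  rcases s with i | e
  · rw [Pi.zero_apply, ← hV i, ← sumOn_singleton (Sum.inl i) d, sumOn, sumOn]
    refine Finset.sum_congr rfl fun s _ => ?_
    rcases s with j | e
    · have : (Sum.inl j : Src1 G) ∈ A1 G i ↔ (Sum.inl j : Src1 G) ∈ ({Sum.inl i} : Set (Src1 G)) := by
        rw [Set.mem_singleton_iff, Sum.inl.injEq]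
        exact Iff.rfl
      classical
      simp only [Set.indicator_apply, this]
    · classical
      simp [Set.indicator_apply, hE]
  · exact hE e

end Sources

lemma exists_decoder {X Y Z : Type} [Nonempty Z] {f : X → Y} {g : X → Z}
    (h : ∀ x y, f x = f y → g x = g y) : ∃ ψ : Y → Z, ∀ x, ψ (f x) = g x := by
  classical
  exact ⟨Function.extend f g fun _ => Classical.arbitrary Z,
    fun x => Function.FactorsThrough.extend_apply (fun a b hab => h a b hab) _ x⟩

lemma exists_injective_encoding {T A : Type} [Fintype T] [Zero A] {n : ℕ}
    (h : Fintype.card T ≤ n) : ∃ c : (T → A) → (Fin n → A), Function.Injective c := by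
  obtain ⟨g⟩ : Nonempty (T ↪ Fin n) :=
    Function.Embedding.nonempty_of_card_le (by simpa using h)
  refine ⟨fun v => Function.extend g v 0, fun v w hvw => ?_⟩
  funext t
  simpa [g.injective.extend_apply] using congrFun hvw (g t)

/-- Splitting the coordinates of each edge source between the endpoints of the edge. -/
lemma exists_coordinate_split {V : Type} [DecidableEq V] {G : SimpleGraph V} {n α : ℕ}
    {m : Sym2 V → V → ℕ} (hm : ∀ i j, G.Adj i j → m s(i, j) i + m s(i, j) j = n) (e : Sym2 V) :
    ∃ P : V → Finset (Fin (α * n)), e ∈ G.edgeSet →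
      (∀ i ∈ e, (P i).card = α * m e i) ∧ ∀ i j, e = s(i, j) → ∀ k, k ∈ P i ∨ k ∈ P j := by
  induction e using Sym2.ind with
  | _ a b =>
  by_cases hab : G.Adj a b
  · have hsum := hm a b hab
    have hsum' : α * m s(a, b) a + α * m s(a, b) b = α * n := by rw [← mul_add, hsum]
    obtain ⟨S, -, hS⟩ := Finset.exists_subset_card_eq
      (s := (Finset.univ : Finset (Fin (α * n)))) (n := α * m s(a, b) a) (by simp; omega)
    refine ⟨fun i => if i = a then S else Sᶜ, fun _ => ⟨fun i hi => ?_, fun i j hij k => ?_⟩⟩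
    · rcases Sym2.mem_iff.mp hi with rfl | rfl
      · simpa using hS
      · simp only [hab.ne', if_false, Finset.card_compl, hS, Fintype.card_fin]
        omega
    · have := hab.ne'
      rcases Sym2.eq_iff.mp hij with ⟨rfl, rfl⟩ | ⟨rfl, rfl⟩ <;>
        simp [this, Finset.mem_compl, em, em']
  · exact ⟨fun _ => ∅, fun h => (hab h).elim⟩

section Code

variable {V : Type} [Fintype V] [DecidableEq V] {G : SimpleGraph V} [DecidableRel G.Adj]
  {A : Type} [Field A] [Fintype A]

lemma IsCode1.eq_of_encodings_eq {r l α : ℕ}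
    {φ : ∀ i : V, (↥(A1 G i) → (Fin r → A)) → (Fin (α * l) → A)} (hφ : IsCode1 G A r l α φ)
    {x y : Src1 G → (Fin r → A)}
    (h : ∀ i, φ i (fun a => x a.1) = φ i (fun a => y a.1)) : x = y := by
  obtain ⟨h1, h2, -⟩ := hφ
  have hV : ∀ i, sumOn (A1 G i) (x - y) = 0 := by
    intro i
    obtain ⟨ψ, hψ⟩ := h1 i
    rw [sumOn_sub, sub_eq_zero]
    exact sumOn_eq_of_decodes (f := fun x => φ i fun a => x a.1)
      (fun x y hxy => congrArg (φ i) (funext fun a => hxy a.1 a.2)) hψ (h i)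
  refine sub_eq_zero.mp (eq_zero_of_sumOn_A1_eq_zero hV ?_)
  rintro ⟨e, he⟩
  induction e using Sym2.ind with
  | _ i j =>
  obtain ⟨ψ, hψ⟩ := h2 i j he
  have hU : sumOn (A1 G i ∪ A1 G j) (x - y) = 0 := by
    rw [sumOn_sub, sub_eq_zero]
    refine sumOn_eq_of_decodes (f := fun x => (φ i fun a => x a.1, φ j fun a => x a.1))
      (ψ := fun p => ψ p.1 p.2) (fun x y hxy => ?_) hψ (Prod.ext (h i) (h j))
    exact Prod.ext (congrArg (φ i) (funext fun a => hxy a.1 (Or.inl a.2)))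
      (congrArg (φ j) (funext fun a => hxy a.1 (Or.inr a.2)))
  have := sumOn_union_add_inter (A1 G i) (A1 G j) (x - y)
  rwa [hU, hV, hV, A1_inter_of_adj he, sumOn_singleton, zero_add, zero_add] at this

lemma IsCode1.rate_le {r l α : ℕ}
    {φ : ∀ i : V, (↥(A1 G i) → (Fin r → A)) → (Fin (α * l) → A)} (hφ : IsCode1 G A r l α φ) :
    r * (Fintype.card V + G.edgeFinset.card) ≤ l * (α * Fintype.card V) := by
  have hcard := Fintype.card_le_of_injective
    (fun (x : Src1 G → (Fin r → A)) i => φ i (fun a => x a.1))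
    fun x y hxy => hφ.eq_of_encodings_eq fun i => congrFun hxy i
  simp only [Fintype.card_fun, Fintype.card_fin, Fintype.card_sum, ← pow_mul] at hcard
  rw [Nat.pow_le_pow_iff_right Fintype.one_lt_card] at hcard
  rw [SimpleGraph.edgeFinset, Set.toFinset_card]
  linarith

/-- Encodings that determine the sum over each `A1 G i`, and jointly at the endpoints of an edge
determine the source of that edge, form a code. -/
lemma isCode1_of_determines {r l α : ℕ}
    {φ : ∀ i : V, (↥(A1 G i) → (Fin r → A)) → (Fin (α * l) → A)}
    (hV : ∀ (i : V) (x y : Src1 G → (Fin r → A)),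
      φ i (fun a => x a.1) = φ i (fun a => y a.1) → sumOn (A1 G i) x = sumOn (A1 G i) y)
    (hE : ∀ (i j : V) (h : G.Adj i j) (x y : Src1 G → (Fin r → A)),
      φ i (fun a => x a.1) = φ i (fun a => y a.1) → φ j (fun a => x a.1) = φ j (fun a => y a.1) →
        x (Sum.inr ⟨s(i, j), h⟩) = y (Sum.inr ⟨s(i, j), h⟩)) :
    IsCode1 G A r l α φ := by
  refine ⟨fun i => ?_, fun i j hij => ?_, ?_⟩
  · obtain ⟨ψ, hψ⟩ := exists_decoder
      (f := fun x : Src1 G → (Fin r → A) =>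
        (φ i fun a => x a.1, fun a : ↥((A1 G i)ᶜ) => x a.1))
      (g := fun x => ∑ s, x s) fun x y hxy => by
        obtain ⟨h1, h2⟩ := Prod.ext_iff.mp hxy
        rw [← sumOn_add_sumOn_compl (A1 G i) x, ← sumOn_add_sumOn_compl (A1 G i) y, hV i x y h1,
          sumOn_congr (B := (A1 G i)ᶜ) fun s hs => congrFun h2 ⟨s, hs⟩]
    exact ⟨fun p q => ψ (p, q), hψ⟩
  · obtain ⟨ψ, hψ⟩ := exists_decoder
      (f := fun x : Src1 G → (Fin r → A) =>
        (φ i fun a => x a.1, φ j fun a => x a.1, fun a : ↥((A1 G i ∪ A1 G j)ᶜ) => x a.1))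
      (g := fun x => ∑ s, x s) fun x y hxy => by
        obtain ⟨h1, h2⟩ := Prod.ext_iff.mp hxy
        obtain ⟨h2, h3⟩ := Prod.ext_iff.mp h2
        have hx := sumOn_union_add_inter (A1 G i) (A1 G j) x
        have hy := sumOn_union_add_inter (A1 G i) (A1 G j) y
        rw [A1_inter_of_adj hij, sumOn_singleton] at hx hy
        rw [hV i x y h1, hV j x y h2, hE i j hij x y h1 h2, ← hy] at hx
        rw [← sumOn_add_sumOn_compl (A1 G i ∪ A1 G j) x,
          ← sumOn_add_sumOn_compl (A1 G i ∪ A1 G j) y, add_right_cancel hx,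
          sumOn_congr (B := (A1 G i ∪ A1 G j)ᶜ) fun s hs => congrFun h3 ⟨s, hs⟩]
    exact ⟨fun p q t => ψ (p, q, t), hψ⟩
  · refine exists_decoder (f := fun (x : Src1 G → (Fin r → A)) i => φ i fun a => x a.1)
      (g := fun x => ∑ s, x s) fun x y hxy => ?_
    have hd : x - y = 0 := by
      refine eq_zero_of_sumOn_A1_eq_zero
        (fun i => by rw [sumOn_sub, hV i x y (congrFun hxy i), sub_self]) ?_
      rintro ⟨e, he⟩
      induction e using Sym2.ind with
      | _ i j =>
      exact sub_eq_zero.mpr (hE i j he x y (congrFun hxy i) (congrFun hxy j))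
    rw [sub_eq_zero.mp hd]

lemma Feas1.exists_isCode1 {m : Sym2 V → V → ℕ} (hm : Feas1 G m) (α : ℕ) :
    ∃ φ : ∀ i : V, (↥(A1 G i) → (Fin (α * Fintype.card V) → A)) →
        (Fin (α * (Fintype.card V + G.edgeFinset.card)) → A),
      IsCode1 G A (α * Fintype.card V) (Fintype.card V + G.edgeFinset.card) α φ := by
  classical
  choose P hP using exists_coordinate_split (α := α) hm.1
  let T : V → Type := fun i => Fin (α * Fintype.card V) ⊕
    (Σ e : {e // e ∈ G.edgeFinset.filter (fun e => i ∈ e)}, {k // k ∈ P e.1 i})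
  have hT : ∀ i, Fintype.card (T i) ≤ α * (Fintype.card V + G.edgeFinset.card) := by
    intro i
    have hsum : ∑ e : {e // e ∈ G.edgeFinset.filter (fun e => i ∈ e)}, (P e.1 i).card
        = α * ∑ e ∈ G.edgeFinset.filter (fun e => i ∈ e), m e i := by
      rw [Finset.sum_coe_sort _ (fun e => (P e i).card), Finset.mul_sum]
      refine Finset.sum_congr rfl fun e he => ?_
      rw [Finset.mem_filter, SimpleGraph.mem_edgeFinset] at he
      exact (hP e he.1).1 i he.2
    simp only [T, Fintype.card_sum, Fintype.card_fin, Fintype.card_sigma, Fintype.card_coe]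
    rw [hsum, mul_add]
    exact Nat.add_le_add_left (Nat.mul_le_mul_left α (hm.2 i)) _
  choose c hc using fun i => exists_injective_encoding (A := A) (hT i)
  have hmem : ∀ {i} (e : {e // e ∈ G.edgeFinset.filter (fun e => i ∈ e)}),
      e.1 ∈ G.edgeSet ∧ i ∈ e.1 := fun e => by
    simpa only [Finset.mem_filter, SimpleGraph.mem_edgeFinset] using e.2
  let φ : ∀ i : V, (↥(A1 G i) → (Fin (α * Fintype.card V) → A)) →
      (Fin (α * (Fintype.card V + G.edgeFinset.card)) → A) := fun i v =>
    c i (Sum.elim (fun k => (∑ a, v a) k)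
      fun p => v ⟨Sum.inr ⟨p.1.1, (hmem p.1).1⟩, (hmem p.1).2⟩ p.2.1)
  have hcoord : ∀ (i : V) (x y : Src1 G → (Fin (α * Fintype.card V) → A)),
      φ i (fun a => x a.1) = φ i (fun a => y a.1) → ∀ (e : Sym2 V) (he : e ∈ G.edgeSet), i ∈ e →
        ∀ k ∈ P e i, x (Sum.inr ⟨e, he⟩) k = y (Sum.inr ⟨e, he⟩) k := by
    intro i x y h e he hi k hk
    exact congrFun (hc i h) (Sum.inr ⟨⟨e, by simpa [hi] using he⟩, ⟨k, hk⟩⟩)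
  refine ⟨φ, isCode1_of_determines (fun i x y h => ?_) fun i j hij x y h1 h2 => ?_⟩
  · have hsub : ∀ z : Src1 G → (Fin (α * Fintype.card V) → A),
        sumOn (A1 G i) z = ∑ a : ↥(A1 G i), z a.1 := by
      intro z
      simp only [sumOn, Set.indicator_apply]
      rw [← Finset.sum_filter]
      exact Finset.sum_subtype _ (by simp) _
    rw [hsub, hsub]
    funext k
    exact congrFun (hc i h) (Sum.inl k)
  · funext k
    rcases (hP s(i, j) hij).2 i j rfl k with hk | hk
    · exact hcoord i x y h1 _ hij (Sym2.mem_mk_left i j) k hk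
    · exact hcoord j x y h2 _ hij (Sym2.mem_mk_right i j) k hk

end Code

/-- If the finite connected simple graph `G` admits a feasible CODE-FEAS-1 assignment,
then for every finite field `A` and integer `α ≥ 1` the Construction-1 sum-network built
from `G` with bottleneck capacity `α` has capacity exactly `α|Ṽ|/(|Ṽ|+|Ẽ|)`: a
Construction-1 `(α|Ṽ|, |Ṽ|+|Ẽ|)`-code of capacity `α` exists, and every Construction-1
`(r,l)`-code of capacity `α` satisfies `r·(|Ṽ|+|Ẽ|) ≤ l·α·|Ṽ|`. -/
theorem construction1_capacity {V : Type} [Fintype V] [DecidableEq V]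
    (G : SimpleGraph V) [DecidableRel G.Adj] (hG : G.Connected)
    (hfeas : ∃ m : Sym2 V → V → ℕ, Feas1 G m)
    (A : Type) [Field A] [Fintype A] (α : ℕ) (hα : 1 ≤ α) :
    (∃ φ : ∀ i : V, (↥(A1 G i) → (Fin (α * Fintype.card V) → A)) →
        (Fin (α * (Fintype.card V + G.edgeFinset.card)) → A),
      IsCode1 G A (α * Fintype.card V) (Fintype.card V + G.edgeFinset.card) α φ) ∧
    (∀ r l : ℕ, 0 < r → 0 < l →
      (∃ φ : ∀ i : V, (↥(A1 G i) → (Fin r → A)) → (Fin (α * l) → A),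
        IsCode1 G A r l α φ) →
      r * (Fintype.card V + G.edgeFinset.card) ≤ l * (α * Fintype.card V)) := by
  obtain ⟨m, hm⟩ := hfeas
  exact ⟨hm.exists_isCode1 α, fun r l _ _ ⟨_, hφ⟩ => hφ.rate_le⟩
end

section
/- Let G̃ be a finite connected biregular bipartite simple graph with parts of sizes n_l and n_r whose vertices have degrees d_l and d_r respectively (so n_l·d_l = n_r·d_r = |Ẽ|), with |Ẽ| ≥ n_l + n_r, and let A be a finite field. Then the Construction-1 sum-network built from G̃ with α = 1 has capacity (n_l+n_r)/((n_l+n_r) + n_l·d_l), which equals 2/(2 + d_av) where d_av = (n_l·d_l + n_r·d_r)/(n_l+n_r) is the average degree: there exists a Construction-1 (n_l+n_r, (n_l+n_r) + n_l·d_l)-code of capacity 1, and every Construction-1 (r,l)-code of capacity 1 satisfies r·((n_l+n_r) + n_l·d_l) ≤ l·(n_l+n_r). -/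
@[simp] lemma inl_mem_A1 {V : Type} {G : SimpleGraph V} {i j : V} :
    (Sum.inl j : Src1 G) ∈ A1 G i ↔ j = i := Iff.rfl

@[simp] lemma inr_mem_A1 {V : Type} {G : SimpleGraph V} {i : V} {e : G.edgeSet} :
    (Sum.inr e : Src1 G) ∈ A1 G i ↔ i ∈ (e : Sym2 V) := Iff.rfl

/-- The set `A1 G i` as a finite set of sources. -/
noncomputable def A1Finset {V : Type} [Fintype V] [DecidableEq V] (G : SimpleGraph V)
    [DecidableRel G.Adj] (i : V) : Finset (Src1 G) :=
  letI := Classical.decPred (· ∈ A1 G i)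
  Finset.univ.filter (· ∈ A1 G i)

section Sources

variable {V : Type} [Fintype V] [DecidableEq V] {G : SimpleGraph V} [DecidableRel G.Adj]

@[simp] lemma mem_A1Finset {i : V} {s : Src1 G} : s ∈ A1Finset G i ↔ s ∈ A1 G i := by
  simp [A1Finset]

lemma A1Finset_inter {i j : V} (h : G.Adj i j) :
    A1Finset G i ∩ A1Finset G j = {Sum.inr ⟨s(i, j), h⟩} := by
  ext s
  rcases s with k | ⟨e, he⟩
  · simp only [Finset.mem_inter, mem_A1Finset, inl_mem_A1, Finset.mem_singleton, reduceCtorEq,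
      iff_false, not_and]
    rintro rfl hk
    exact h.ne hk
  · simp only [Finset.mem_inter, mem_A1Finset, inr_mem_A1, Finset.mem_singleton, Sum.inr.injEq]
    exact (Sym2.mem_and_mem_iff h.ne).trans Subtype.mk_eq_mk.symm

variable {M : Type*} [AddCommGroup M]

/-- The sums over `A_i`, `A_j` and `A_i ∪ A_j` differ by the source of the edge `ij`. -/
lemma sum_A1Finset_union_add {i j : V} (h : G.Adj i j) (x : Src1 G → M) :
    ∑ s ∈ A1Finset G i ∪ A1Finset G j, x s + x (Sum.inr ⟨s(i, j), h⟩) =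
      ∑ s ∈ A1Finset G i, x s + ∑ s ∈ A1Finset G j, x s := by
  rw [← Finset.sum_union_inter, A1Finset_inter h, Finset.sum_singleton]

/-- A source configuration is determined by its edge sources and its sums over the `A_i`. -/
lemma eq_of_sum_A1Finset_eq {x y : Src1 G → M}
    (hσ : ∀ i, ∑ s ∈ A1Finset G i, x s = ∑ s ∈ A1Finset G i, y s)
    (he : ∀ e, x (Sum.inr e) = y (Sum.inr e)) : x = y := by
  funext s
  rcases s with i | e
  · have hi : (Sum.inl i : Src1 G) ∈ A1Finset G i := by simp
    have hrest : ∑ s ∈ (A1Finset G i).erase (Sum.inl i), x s =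
        ∑ s ∈ (A1Finset G i).erase (Sum.inl i), y s := by
      refine Finset.sum_congr rfl ?_
      rintro (k | e) hs
      · simp_all
      · exact he e
    have := hσ i
    rwa [← Finset.add_sum_erase _ _ hi, ← Finset.add_sum_erase _ y hi, hrest,
      add_left_inj] at this
  · exact he e

lemma sum_eq_of_sum_finset_eq {ι : Type*} [Fintype ι] [DecidableEq ι] {x y : ι → M}
    (B : Finset ι) (hB : ∑ s ∈ B, x s = ∑ s ∈ B, y s) (hc : ∀ s ∉ B, x s = y s) :
    ∑ s, x s = ∑ s, y s := by
  rw [← Finset.sum_add_sum_compl B x, ← Finset.sum_add_sum_compl B y, hB]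
  congr 1
  exact Finset.sum_congr rfl fun s hs => hc s (Finset.mem_compl.mp hs)

end Sources

section Converse

variable {V : Type} [Fintype V] [DecidableEq V] {G : SimpleGraph V} [DecidableRel G.Adj]
  {A : Type} [Field A] [Fintype A] {r l α : ℕ}
  {φ : ∀ i : V, (↥(A1 G i) → (Fin r → A)) → (Fin (α * l) → A)}

/-- The values carried by all bottleneck edges determine every source. -/
lemma IsCode1.injective (h : IsCode1 G A r l α φ) :
    Function.Injective fun (x : Src1 G → Fin r → A) i => φ i fun a => x a.1 := by
  classical
  obtain ⟨hv, he, -⟩ := h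
  intro x y hxy
  have hφ (i : V) : (φ i fun a => x a.1) = φ i fun a => y a.1 := congrFun hxy i
  have restrict (B : Finset (Src1 G)) (i : V) (hB : ∀ s ∈ A1 G i, s ∈ B)
      (z : Src1 G → Fin r → A) :
      (fun a : A1 G i => if a.1 ∈ B then z a.1 else 0) = fun a => z a.1 := by
    funext a
    exact if_pos (hB _ a.2)
  have hσ (i : V) : ∑ s ∈ A1Finset G i, x s = ∑ s ∈ A1Finset G i, y s := by
    obtain ⟨ψ, hψ⟩ := hv i
    have key (z : Src1 G → Fin r → A) :
        ψ (φ i fun a => z a.1) 0 = ∑ s ∈ A1Finset G i, z s := by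
      have := hψ fun s => if s ∈ A1Finset G i then z s else 0
      rw [restrict _ i (fun s hs => mem_A1Finset.mpr hs), Finset.sum_ite_mem,
        Finset.univ_inter] at this
      rw [← this]
      congr 1
      funext a
      exact (if_neg (mem_A1Finset.not.mpr a.2)).symm
    rw [← key, ← key, hφ]
  refine eq_of_sum_A1Finset_eq hσ ?_
  rintro ⟨e, hadj⟩
  induction e using Sym2.ind with
  | _ i j =>
    obtain ⟨ψ, hψ⟩ := he i j hadj
    have key (z : Src1 G → Fin r → A) : ψ (φ i fun a => z a.1) (φ j fun a => z a.1) 0 =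
        ∑ s ∈ A1Finset G i ∪ A1Finset G j, z s := by
      have := hψ fun s => if s ∈ A1Finset G i ∪ A1Finset G j then z s else 0
      rw [restrict _ i fun s hs => Finset.mem_union_left _ (mem_A1Finset.mpr hs),
        restrict _ j fun s hs => Finset.mem_union_right _ (mem_A1Finset.mpr hs),
        Finset.sum_ite_mem, Finset.univ_inter] at this
      rw [← this]
      congr 1
      funext a
      refine (if_neg ?_).symm
      simpa using a.2
    have hx := sum_A1Finset_union_add hadj x
    rw [← key, hφ i, hφ j, key, hσ i, hσ j, ← sum_A1Finset_union_add hadj y] at hx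
    exact add_left_cancel hx

lemma IsCode1.mul_card_le (h : IsCode1 G A r l α φ) :
    r * (Fintype.card V + G.edgeFinset.card) ≤ α * l * Fintype.card V := by
  classical
  have hcard := Fintype.card_le_of_injective _ h.injective
  simp only [Fintype.card_pi, Finset.prod_const, Finset.card_univ, Fintype.card_fin,
    Fintype.card_sum, ← pow_mul] at hcard
  rw [← SimpleGraph.edgeFinset_card] at hcard
  exact (Nat.pow_le_pow_iff_right Fintype.one_lt_card).mp hcard

end Converse

section Achievability

variable {V : Type} [Fintype V] {G : SimpleGraph V} {A : Type} [Field A]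

/-- The symbols sent over the bottleneck edge of `i`: the sum of the sources in `A_i`, and for
each edge at `i` the coordinates of its source that `P i` selects. -/
noncomputable def sumAndEdgeSymbols {r : ℕ} (P : V → Fin r → Prop) (i : V)
    (x : A1 G i → Fin r → A) :
    Fin r ⊕ ({e : G.edgeSet // i ∈ (e : Sym2 V)} × {k // P i k}) → A :=
  letI := Fintype.ofFinite (A1 G i)
  Sum.elim (∑ s, x s) fun p => x ⟨Sum.inr p.1.1, p.1.2⟩ p.2.1

lemma edge_eq_of_sumAndEdgeSymbols_eq {r : ℕ} {P : V → Fin r → Prop} {i j : V}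
    (hadj : G.Adj i j) (hP : ∀ k, P i k ∨ P j k) {x y : Src1 G → Fin r → A}
    (hi : (sumAndEdgeSymbols P i fun a => x a.1) = sumAndEdgeSymbols P i fun a => y a.1)
    (hj : (sumAndEdgeSymbols P j fun a => x a.1) = sumAndEdgeSymbols P j fun a => y a.1) :
    x (Sum.inr ⟨s(i, j), hadj⟩) = y (Sum.inr ⟨s(i, j), hadj⟩) := by
  funext k
  rcases hP k with hk | hk
  · exact congrFun hi (Sum.inr (⟨⟨s(i, j), hadj⟩, Sym2.mem_mk_left i j⟩, ⟨k, hk⟩))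
  · exact congrFun hj (Sum.inr (⟨⟨s(i, j), hadj⟩, Sym2.mem_mk_right i j⟩, ⟨k, hk⟩))

variable [DecidableEq V] [DecidableRel G.Adj]

lemma sum_eq_of_sumAndEdgeSymbols_eq {r : ℕ} {P : V → Fin r → Prop} {i : V}
    {x y : Src1 G → Fin r → A}
    (h : (sumAndEdgeSymbols P i fun a => x a.1) = sumAndEdgeSymbols P i fun a => y a.1) :
    ∑ s ∈ A1Finset G i, x s = ∑ s ∈ A1Finset G i, y s := by
  let := Fintype.ofFinite (A1 G i)
  have hs : ∑ s : A1 G i, x s = ∑ s : A1 G i, y s :=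
    funext fun k => congrFun h (Sum.inl k)
  rwa [← Finset.sum_subtype (A1Finset G i) (fun _ => mem_A1Finset) x,
    ← Finset.sum_subtype (A1Finset G i) (fun _ => mem_A1Finset) y] at hs

lemma exists_isCode1 [Fintype A] {r l α : ℕ} (P : V → Fin r → Prop)
    (hP : ∀ i j, G.Adj i j → ∀ k, P i k ∨ P j k)
    (hcard : ∀ i, r + G.degree i * Nat.card {k // P i k} = α * l) :
    ∃ φ : ∀ i : V, (↥(A1 G i) → (Fin r → A)) → (Fin (α * l) → A), IsCode1 G A r l α φ := by
  classical
  have hdeg (i : V) : Nat.card {e : G.edgeSet // i ∈ (e : Sym2 V)} = G.degree i := by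
    rw [← SimpleGraph.card_incidenceSet_eq_degree, ← Nat.card_eq_fintype_card]
    exact Nat.card_congr (Equiv.subtypeSubtypeEquivSubtypeInter (· ∈ G.edgeSet) (i ∈ ·))
  let g (i : V) : Fin (α * l) ≃ Fin r ⊕ ({e : G.edgeSet // i ∈ (e : Sym2 V)} × {k // P i k}) :=
    (Finite.equivFinOfCardEq (by
      rw [Nat.card_sum, Nat.card_prod, Nat.card_fin, hdeg, hcard])).symm
  let φ (i : V) (x : A1 G i → Fin r → A) : Fin (α * l) → A := sumAndEdgeSymbols P i x ∘ g i
  have hφ {i : V} {x y : Src1 G → Fin r → A}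
      (h : (φ i fun a => x a.1) = φ i fun a => y a.1) :
      (sumAndEdgeSymbols P i fun a => x a.1) = sumAndEdgeSymbols P i fun a => y a.1 :=
    (g i).surjective.injective_comp_right h
  refine ⟨φ, fun i => ?_, fun i j hadj => ?_, ?_⟩
  · have hf : Function.FactorsThrough (fun x : Src1 G → Fin r → A => ∑ s, x s)
        (fun x => (φ i fun a => x a.1, fun a : ↥(A1 G i)ᶜ => x a.1)) := by
      intro x y hxy
      obtain ⟨h1, h2⟩ := Prod.mk.inj hxy
      refine sum_eq_of_sum_finset_eq (A1Finset G i) (sum_eq_of_sumAndEdgeSymbols_eq (hφ h1)) ?_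
      intro s hs
      exact congrFun h2 ⟨s, mem_A1Finset.not.mp hs⟩
    exact ⟨fun u v => Function.extend _ _ (fun _ => 0) (u, v), fun x => hf.extend_apply _ x⟩
  · have hf : Function.FactorsThrough (fun x : Src1 G → Fin r → A => ∑ s, x s)
        (fun x => (φ i fun a => x a.1, φ j fun a => x a.1,
          fun a : ↥(A1 G i ∪ A1 G j)ᶜ => x a.1)) := by
      intro x y hxy
      obtain ⟨h1, h2⟩ := Prod.mk.inj hxy
      obtain ⟨h2, h3⟩ := Prod.mk.inj h2
      refine sum_eq_of_sum_finset_eq (A1Finset G i ∪ A1Finset G j) ?_ ?_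
      · have hx := sum_A1Finset_union_add hadj x
        rw [sum_eq_of_sumAndEdgeSymbols_eq (hφ h1), sum_eq_of_sumAndEdgeSymbols_eq (hφ h2),
          edge_eq_of_sumAndEdgeSymbols_eq hadj (hP i j hadj) (hφ h1) (hφ h2),
          ← sum_A1Finset_union_add hadj y] at hx
        exact add_right_cancel hx
      · intro s hs
        exact congrFun h3 ⟨s, by simpa using hs⟩
    exact ⟨fun u v w => Function.extend _ _ (fun _ => 0) (u, v, w), fun x => hf.extend_apply _ x⟩
  · have hf : Function.FactorsThrough (fun x : Src1 G → Fin r → A => ∑ s, x s)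
        (fun x i => φ i fun a => x a.1) := by
      intro x y hxy
      have h (i : V) := hφ (congrFun hxy i)
      have : x = y := by
        refine eq_of_sum_A1Finset_eq (fun i => sum_eq_of_sumAndEdgeSymbols_eq (h i)) ?_
        rintro ⟨e, hadj⟩
        induction e using Sym2.ind with
        | _ i j => exact edge_eq_of_sumAndEdgeSymbols_eq hadj (hP i j hadj) (h i) (h j)
      rw [this]
    exact ⟨fun u => Function.extend _ _ (fun _ => 0) u, fun x => hf.extend_apply _ x⟩

end Achievability

/-- For a finite connected biregular bipartite simple graph `G` with parts `L, R` of sizes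
`n_l, n_r` and degrees `d_l, d_r` (so `n_l·d_l = n_r·d_r = |Ẽ|`), with `|Ẽ| ≥ n_l + n_r`,
and any finite field `A`, the Construction-1 sum-network built from `G` with `α = 1` has
capacity exactly `(n_l+n_r)/((n_l+n_r) + n_l·d_l) = 2/(2 + d_av)`: there is a
Construction-1 `(n_l+n_r, (n_l+n_r) + n_l·d_l)`-code of capacity `1`, and every
Construction-1 `(r,l)`-code of capacity `1` satisfies
`r·((n_l+n_r) + n_l·d_l) ≤ l·(n_l+n_r)`. -/
theorem bipartite_graph_capacity {V : Type} [Fintype V] [DecidableEq V]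
    (G : SimpleGraph V) [DecidableRel G.Adj] (hG : G.Connected)
    (L R : Finset V) (dl dr : ℕ) (hdl : 1 ≤ dl) (hdr : 1 ≤ dr)
    (hpart : ∀ v : V, v ∈ L ↔ v ∉ R)
    (hbip : ∀ i j : V, G.Adj i j → (i ∈ L ∧ j ∈ R) ∨ (i ∈ R ∧ j ∈ L))
    (hdegL : ∀ i ∈ L, G.degree i = dl) (hdegR : ∀ i ∈ R, G.degree i = dr)
    (hE : L.card + R.card ≤ G.edgeFinset.card)
    (A : Type) [Field A] [Fintype A] :
    (∃ φ : ∀ i : V, (↥(A1 G i) → (Fin (L.card + R.card) → A)) →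
        (Fin (1 * ((L.card + R.card) + L.card * dl)) → A),
      IsCode1 G A (L.card + R.card) ((L.card + R.card) + L.card * dl) 1 φ) ∧
    (∀ r l : ℕ, 0 < r → 0 < l →
      (∃ φ : ∀ i : V, (↥(A1 G i) → (Fin r → A)) → (Fin (1 * l) → A),
        IsCode1 G A r l 1 φ) →
      r * ((L.card + R.card) + L.card * dl) ≤ l * (L.card + R.card)) := by
  classical
  have hV : Fintype.card V = L.card + R.card := by
    have hLR : R = Lᶜ := by
      ext v
      rw [Finset.mem_compl, hpart, not_not]
    rw [hLR, Finset.card_add_card_compl]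
  have hcross (i j : V) (h : G.Adj i j) : i ∈ L ∧ j ∉ L ∨ i ∉ L ∧ j ∈ L := by
    have := hbip i j h
    have := hpart i
    have := hpart j
    tauto
  have hbi : G.IsBipartiteWith (L : Set V) (R : Set V) :=
    ⟨Set.disjoint_left.mpr fun v hv => (hpart v).mp hv, fun {i j} h => hbip i j h⟩
  have hEL : L.card * dl = G.edgeFinset.card := by
    rw [← SimpleGraph.isBipartiteWith_sum_degrees_eq_card_edges hbi, Finset.sum_congr rfl hdegL,
      Finset.sum_const, smul_eq_mul]
  have hER : R.card * dr = G.edgeFinset.card := by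
    rw [← SimpleGraph.isBipartiteWith_sum_degrees_eq_card_edges' hbi, Finset.sum_congr rfl hdegR,
      Finset.sum_const, smul_eq_mul]
  refine ⟨?_, fun r l _ _ ⟨φ, hφ⟩ => ?_⟩
  · have hlow : Nat.card {k : Fin (L.card + R.card) // (k : ℕ) < L.card} = L.card := by
      rw [Nat.card_eq_fintype_card, Fintype.card_subtype, Fin.card_filter_val_lt]
      omega
    have hhigh : Nat.card {k : Fin (L.card + R.card) // ¬ (k : ℕ) < L.card} = R.card := by
      rw [Nat.card_eq_fintype_card, Fintype.card_subtype_compl, ← Nat.card_eq_fintype_card,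
        ← Nat.card_eq_fintype_card, hlow, Nat.card_fin, Nat.add_sub_cancel_left]
    refine exists_isCode1 (fun i k => (k : ℕ) < L.card ↔ i ∈ L) (fun i j h k => ?_) fun i => ?_
    · have := hcross i j h
      tauto
    · by_cases hi : i ∈ L
      · simp only [hi, iff_true]
        rw [hlow, hdegL i hi, one_mul, mul_comm dl]
      · have hiR : i ∈ R := by_contra fun h => hi ((hpart i).mpr h)
        simp only [hi, iff_false]
        rw [hhigh, hdegR i hiR, one_mul, mul_comm dr, hER, hEL]
  · have := hφ.mul_card_le
    rwa [hV, ← hEL, one_mul] at this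
end
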